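/- arXiv:0805.1781 — 2 statements merged into one kernel-verified Lean document; each statement's English description precedes it below -/
import Mathlib

section
/- Let δ, β > 0 and let f, p : ℝ → [0, ∞) be measurable with f locally integrable. Then for every t ≥ 0, ∫₀^t e^{δ(s−t) + β ∫_{s−t}^0 f(τ) dτ} ( ∫_{−t}^{s−t} p(σ) e^{δ(σ − s + t) + β ∫_σ^{s−t} f(τ) dτ} dσ ) ds ≤ ( ∫_{−∞}^0 e^{(δ/2)s + β ∫_s^0 f(τ) dτ} ds ) · ( ∫_{−∞}^0 p(σ) e^{(δ/2)σ + β ∫_σ^0 f(τ) dτ} dσ ). -/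
open MeasureTheory Set ENNReal

/-- For `δ, β > 0` and measurable nonnegative `f, p` with `f` locally integrable,
for every `t ≥ 0`,
`∫₀^t e^{δ(s-t) + β∫_{s-t}^0 f} (∫_{-t}^{s-t} p(σ) e^{δ(σ-s+t) + β∫_σ^{s-t} f} dσ) ds
  ≤ (∫_{-∞}^0 e^{(δ/2)s + β∫_s^0 f} ds) · (∫_{-∞}^0 p(σ) e^{(δ/2)σ + β∫_σ^0 f} dσ)`,
stated with lower integrals in `ℝ≥0∞` so that the right-hand side is allowed
to be infinite. -/
theorem stmt_10 (δ β : ℝ) (hδ : 0 < δ) (hβ : 0 < β)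
    (f p : ℝ → ℝ) (hfnonneg : ∀ τ : ℝ, 0 ≤ f τ) (hpnonneg : ∀ σ : ℝ, 0 ≤ p σ)
    (hfmeas : Measurable f) (hpmeas : Measurable p) (hfloc : LocallyIntegrable f)
    (t : ℝ) (ht : 0 ≤ t) :
    (∫⁻ s in Ioc (0:ℝ) t,
        ENNReal.ofReal (Real.exp (δ * (s - t) + β * ∫ τ in (s - t)..0, f τ)) *
          ∫⁻ σ in Ioc (-t) (s - t),
            ENNReal.ofReal (p σ) *
              ENNReal.ofReal (Real.exp (δ * (σ - s + t) + β * ∫ τ in σ..(s - t), f τ)))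
      ≤ (∫⁻ s in Iic (0:ℝ),
            ENNReal.ofReal (Real.exp ((δ / 2) * s + β * ∫ τ in s..0, f τ))) *
        (∫⁻ σ in Iic (0:ℝ),
            ENNReal.ofReal (p σ) *
              ENNReal.ofReal (Real.exp ((δ / 2) * σ + β * ∫ τ in σ..0, f τ))) := by
  have hii : ∀ a b : ℝ, IntervalIntegrable f volume a b := fun a b =>
    (hfloc.integrableOn_isCompact isCompact_uIcc).intervalIntegrable
  have hcont : Continuous fun s : ℝ => ∫ τ in s..0, f τ := by
    simp_rw [fun s : ℝ => intervalIntegral.integral_symm (f := f) (μ := volume) 0 s]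
    exact (intervalIntegral.continuous_primitive hii 0).neg
  set g : ℝ → ℝ≥0∞ := fun s =>
    ENNReal.ofReal (Real.exp ((δ / 2) * s + β * ∫ τ in s..0, f τ)) with hg
  have hgmeas : Measurable g :=
    (ENNReal.continuous_ofReal.comp (Real.continuous_exp.comp
      ((continuous_const.mul continuous_id).add (continuous_const.mul hcont)))).measurable
  set C : ℝ≥0∞ := ∫⁻ σ in Iic (0:ℝ), ENNReal.ofReal (p σ) * g σ with hC
  have hinner : ∀ s ∈ Ioc (0:ℝ) t,
      ENNReal.ofReal (Real.exp (δ * (s - t) + β * ∫ τ in (s - t)..0, f τ)) *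
          ∫⁻ σ in Ioc (-t) (s - t),
            ENNReal.ofReal (p σ) *
              ENNReal.ofReal (Real.exp (δ * (σ - s + t) + β * ∫ τ in σ..(s - t), f τ))
        ≤ g (s - t) * C := by
    intro s hs
    have hu : s - t ≤ 0 := sub_nonpos.2 hs.2
    rw [hC, ← lintegral_const_mul' _ _ ENNReal.ofReal_ne_top,
      ← lintegral_const_mul' _ _ ENNReal.ofReal_ne_top]
    refine (setLIntegral_mono' measurableSet_Ioc fun σ hσ => ?_).trans
      (lintegral_mono_set fun σ hσ => hσ.2.trans hu)
    rw [mul_left_comm, mul_left_comm (g (s - t))]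
    refine mul_le_mul_right ?_ _
    simp only [hg]
    rw [← ENNReal.ofReal_mul (Real.exp_nonneg _), ← ENNReal.ofReal_mul (Real.exp_nonneg _),
      ← Real.exp_add, ← Real.exp_add]
    refine ENNReal.ofReal_le_ofReal (Real.exp_le_exp.2 ?_)
    have hadd := intervalIntegral.integral_add_adjacent_intervals (hii σ (s - t)) (hii (s - t) 0)
    have hnonneg : 0 ≤ β * ∫ τ in (s - t)..0, f τ :=
      mul_nonneg hβ.le (intervalIntegral.integral_nonneg hu fun τ _ => hfnonneg τ)
    have hσ' : 0 ≤ δ * (s - t - σ) := mul_nonneg hδ.le (sub_nonneg.2 hσ.2)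
    rw [← hadd]
    linarith
  calc _ ≤ ∫⁻ s in Ioc (0:ℝ) t, g (s - t) * C := setLIntegral_mono' measurableSet_Ioc hinner
    _ = (∫⁻ s in Ioc (0:ℝ) t, g (s - t)) * C :=
        lintegral_mul_const _ (hgmeas.comp (measurable_id.sub_const t))
    _ ≤ (∫⁻ s in Iic (0:ℝ), g s) * C := by
        refine mul_le_mul_left ?_ _
        rw [← lintegral_indicator measurableSet_Ioc, ← lintegral_indicator measurableSet_Iic,
          ← lintegral_sub_right_eq_self (fun s => (Iic (0:ℝ)).indicator g s) t]
        refine lintegral_mono (indicator_le fun s hs => ?_)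
        rw [indicator_of_mem (show s - t ∈ Iic (0:ℝ) from sub_nonpos.2 hs.2)]
end

section
/- Let δ, β > 0 and let f, p : ℝ → [0, ∞) be measurable with f locally integrable. Then for every t ≥ 0, ∫₀^t e^{δ(s−t) + β ∫_{s−t}^0 f(τ) dτ} ( ∫_{−t}^{s−t} p(σ) e^{δ(σ − s + t) + β ∫_σ^{s−t} f(τ) dτ} dσ )² ds ≤ ( ∫_{−∞}^0 e^{(δ/4)s + β ∫_s^0 f(τ) dτ} ds ) · ( ∫_{−∞}^0 p(σ) e^{(3δ/8)σ + β ∫_σ^0 f(τ) dτ} dσ )². -/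
open MeasureTheory Set ENNReal

/-- The exponential weight `s ↦ e^{c s + β ∫_s^0 f}` of a locally integrable `f` is measurable. -/
lemma measurable_ofReal_exp_add_primitive {f : ℝ → ℝ} (hf : LocallyIntegrable f) (c β : ℝ) :
    Measurable fun s : ℝ =>
      ENNReal.ofReal (Real.exp (c * s + β * ∫ τ in s..0, f τ)) := by
  have hcont : Continuous fun s : ℝ => ∫ τ in s..0, f τ := by
    simp_rw [intervalIntegral.integral_symm 0]
    exact (intervalIntegral.continuous_primitive
      (fun a b => (hf.integrableOn_isCompact isCompact_uIcc).intervalIntegrable) 0).neg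
  exact (Continuous.measurable (by fun_prop)).ennreal_ofReal

/-- Pulling the factor `e^{(3δ/8) u}` into the inner integral and extending the integration range
to `(-∞, 0]` bounds the inner integral uniformly in `u ≤ 0`. -/
lemma exp_mul_lintegral_Ioc_le {δ β : ℝ} (hδ : 0 ≤ δ) (hβ : 0 ≤ β) {f : ℝ → ℝ}
    (hf0 : ∀ τ, 0 ≤ f τ) (hf : LocallyIntegrable f) (p : ℝ → ℝ) (a : ℝ) {u : ℝ} (hu : u ≤ 0) :
    ENNReal.ofReal (Real.exp (3 * δ / 8 * u)) *
        (∫⁻ σ in Ioc a u, ENNReal.ofReal (p σ) *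
          ENNReal.ofReal (Real.exp (δ * (σ - u) + β * ∫ τ in σ..u, f τ))) ≤
      ∫⁻ σ in Iic (0:ℝ), ENNReal.ofReal (p σ) *
        ENNReal.ofReal (Real.exp (3 * δ / 8 * σ + β * ∫ τ in σ..0, f τ)) := by
  rw [← lintegral_const_mul' _ _ ofReal_ne_top]
  refine (setLIntegral_mono' measurableSet_Ioc fun σ hσ => ?_).trans
    (lintegral_mono_set fun σ hσ => hσ.2.trans hu)
  rw [mul_left_comm, ← ENNReal.ofReal_mul (Real.exp_nonneg _), ← Real.exp_add]
  have hI : ∀ a b : ℝ, IntervalIntegrable f volume a b := fun a b =>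
    (hf.integrableOn_isCompact isCompact_uIcc).intervalIntegrable
  have hadd := intervalIntegral.integral_add_adjacent_intervals (hI σ u) (hI u 0)
  have hnn : 0 ≤ β * ∫ τ in u..0, f τ :=
    mul_nonneg hβ (intervalIntegral.integral_nonneg hu fun τ _ => hf0 τ)
  have hσu : 0 ≤ δ * (u - σ) := mul_nonneg hδ (sub_nonneg.2 hσ.2)
  refine mul_le_mul_right (ENNReal.ofReal_le_ofReal (Real.exp_le_exp.2 ?_)) _
  rw [← hadd]
  linarith

/-- For `δ, β > 0` and measurable nonnegative `f, p` with `f` locally integrable,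
for every `t ≥ 0`,
`∫₀^t e^{δ(s-t) + β∫_{s-t}^0 f} (∫_{-t}^{s-t} p(σ) e^{δ(σ-s+t) + β∫_σ^{s-t} f} dσ)² ds
  ≤ (∫_{-∞}^0 e^{(δ/4)s + β∫_s^0 f} ds) · (∫_{-∞}^0 p(σ) e^{(3δ/8)σ + β∫_σ^0 f} dσ)²`,
stated with lower integrals in `ℝ≥0∞` so that the right-hand side is allowed
to be infinite. -/
theorem stmt_11 (δ β : ℝ) (hδ : 0 < δ) (hβ : 0 < β)
    (f p : ℝ → ℝ) (hfnonneg : ∀ τ : ℝ, 0 ≤ f τ) (hpnonneg : ∀ σ : ℝ, 0 ≤ p σ)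
    (hfmeas : Measurable f) (hpmeas : Measurable p) (hfloc : LocallyIntegrable f)
    (t : ℝ) (ht : 0 ≤ t) :
    (∫⁻ s in Ioc (0:ℝ) t,
        ENNReal.ofReal (Real.exp (δ * (s - t) + β * ∫ τ in (s - t)..0, f τ)) *
          (∫⁻ σ in Ioc (-t) (s - t),
            ENNReal.ofReal (p σ) *
              ENNReal.ofReal (Real.exp (δ * (σ - s + t) + β * ∫ τ in σ..(s - t), f τ))) ^ 2)
      ≤ (∫⁻ s in Iic (0:ℝ),
            ENNReal.ofReal (Real.exp ((δ / 4) * s + β * ∫ τ in s..0, f τ))) *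
        (∫⁻ σ in Iic (0:ℝ),
            ENNReal.ofReal (p σ) *
              ENNReal.ofReal (Real.exp ((3 * δ / 8) * σ + β * ∫ τ in σ..0, f τ))) ^ 2 := by
  set C := ∫⁻ σ in Iic (0:ℝ), ENNReal.ofReal (p σ) *
    ENNReal.ofReal (Real.exp ((3 * δ / 8) * σ + β * ∫ τ in σ..0, f τ))
  set w : ℝ → ℝ≥0∞ := fun s =>
    ENNReal.ofReal (Real.exp ((δ / 4) * s + β * ∫ τ in s..0, f τ)) with hw
  have hwm : Measurable w := measurable_ofReal_exp_add_primitive hfloc (δ / 4) β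
  calc
    _ ≤ ∫⁻ s in Ioc (0:ℝ) t, (Iic (0:ℝ)).indicator w (s - t) * C ^ 2 := by
      refine setLIntegral_mono' measurableSet_Ioc fun s hs => ?_
      have hu : s - t ≤ 0 := sub_nonpos.2 hs.2
      have hsplit : ENNReal.ofReal (Real.exp (δ * (s - t) + β * ∫ τ in (s - t)..0, f τ)) =
          w (s - t) * ENNReal.ofReal (Real.exp (3 * δ / 8 * (s - t))) ^ 2 := by
        rw [hw, ← ENNReal.ofReal_pow (Real.exp_nonneg _),
          ← ENNReal.ofReal_mul (Real.exp_nonneg _), ← Real.exp_nat_mul, ← Real.exp_add]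
        congr 2
        push_cast
        ring
      rw [indicator_of_mem (mem_Iic.2 hu), hsplit, mul_assoc, ← mul_pow]
      gcongr
      simp_rw [sub_add]
      exact exp_mul_lintegral_Ioc_le hδ.le hβ.le hfnonneg hfloc p (-t) hu
    _ ≤ ∫⁻ s, (Iic (0:ℝ)).indicator w (s - t) * C ^ 2 := setLIntegral_le_lintegral _ _
    _ = ∫⁻ s, (Iic (0:ℝ)).indicator w s * C ^ 2 :=
      lintegral_sub_right_eq_self (fun s => (Iic (0:ℝ)).indicator w s * C ^ 2) t
    _ = (∫⁻ s in Iic (0:ℝ), w s) * C ^ 2 := by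
      rw [lintegral_mul_const _ (hwm.indicator measurableSet_Iic),
        lintegral_indicator measurableSet_Iic]
end
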